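/- Let A be a commutative associative K-algebra and ∂ : A → A a K-linear derivation. If f ∈ A* has finite-dimensional span of multiplication translates (f ∈ A°), then the functional f∘∂ also has finite-dimensional span of multiplication translates; that is, the transpose map ∂* satisfies ∂*(A°) ⊆ A°. -/

import Mathlib

/-- `f ∈ A°`: the span of the multiplication translates `f·g : a ↦ f (g * a)` of the linear
functional `f` is finite-dimensional. -/
def goodFunctional (K : Type*) {A : Type*} [Field K] [CommRing A] [Algebra K A]
    (f : Module.Dual K A) : Prop :=
  FiniteDimensional K (Submodule.span K
    (Set.range fun g : A => f ∘ₗ LinearMap.mulLeft K g))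

/-- for a commutative associative `K`-algebra `A` and a `K`-linear derivation
`∂ : A → A`, if `f ∈ A°` then `f ∘ ∂ ∈ A°`; i.e. the transpose `∂*` satisfies
`∂*(A°) ⊆ A°`. -/
theorem statement2 (K A : Type*) [Field K] [CharZero K] [CommRing A] [Algebra K A]
    (d : Derivation K A A) (f : Module.Dual K A) (hf : goodFunctional K f) :
    goodFunctional K (f ∘ₗ d.toLinearMap) := by
  unfold goodFunctional at hf ⊢
  set V := Submodule.span K (Set.range fun g : A => f ∘ₗ LinearMap.mulLeft K g)
  have hV (g : A) : f ∘ₗ LinearMap.mulLeft K g ∈ V := Submodule.subset_span ⟨g, rfl⟩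
  have hle : Submodule.span K
      (Set.range fun g : A => (f ∘ₗ d.toLinearMap) ∘ₗ LinearMap.mulLeft K g) ≤
      V.map (Module.Dual.transpose (R := K) d.toLinearMap) ⊔ V := by
    rw [Submodule.span_le]
    rintro _ ⟨g, rfl⟩
    have leibniz : (f ∘ₗ d.toLinearMap) ∘ₗ LinearMap.mulLeft K g =
        Module.Dual.transpose (R := K) d.toLinearMap (f ∘ₗ LinearMap.mulLeft K g) +
          f ∘ₗ LinearMap.mulLeft K (d g) := by
      ext a
      simp [Module.Dual.transpose_apply, mul_comm a]
    beta_reduce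
    rw [leibniz]
    exact Submodule.add_mem_sup (Submodule.mem_map_of_mem (hV g)) (hV (d g))
  exact Submodule.finiteDimensional_of_le hle
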